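/- Let $\sigma, b : [0,1] \to \mathbb{R}$ be continuous with $\sigma^2(x) \ge d > 0$ for all $x$, let $\mu$ and $G$ be the associated invariant density and normalising constant, let $\mu_0$ be any probability density on $[0,1]$, and let $f : [0,1] \to \mathbb{R}$ be continuous. Then $Jf$ is twice differentiable on $[0,1]$ and satisfies $\frac{1}{2}\sigma^2(x)\,(Jf)''(x) + b(x)\,(Jf)'(x) = f(x) - \int_0^1 f\,d\mu$ for all $x \in [0,1]$; consequently, if additionally $\int_0^1 f(x)\mu_0(x)\,dx = 0$, then $\frac{1}{2}\sigma^2(x)(Jf)''(x) + b(x)(Jf)'(x) - \int_0^1 \left(\frac{1}{2}\sigma^2(Jf)'' + b\,(Jf)'\right) d\mu_0 = f(x)$ for all $x \in [0,1]$. -/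

import Mathlib

open MeasureTheory intervalIntegral Set

/-- The normalising constant `G` of the invariant density of the reflected diffusion with
drift `b` and squared diffusion coefficient `sq = σ²`. -/
noncomputable def normConst (b sq : ℝ → ℝ) : ℝ :=
  ∫ y in (0:ℝ)..1, (1 / sq y) * Real.exp (∫ z in (0:ℝ)..y, 2 * b z / sq z)

/-- The invariant density `μ` of the reflected diffusion. -/
noncomputable def invDens (b sq : ℝ → ℝ) (x : ℝ) : ℝ :=
  (1 / (normConst b sq * sq x)) * Real.exp (∫ y in (0:ℝ)..x, 2 * b y / sq y)

/-- The integral operator `J` with reference probability density `μ₀`. -/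
noncomputable def Jop (b sq μ₀ f : ℝ → ℝ) (x : ℝ) : ℝ :=
  2 * normConst b sq *
    ∫ y in (0:ℝ)..1,
      (∫ z in (0:ℝ)..y,
          (f z - ∫ w in (0:ℝ)..1, f w * invDens b sq w) * invDens b sq z) *
        ((Icc (0:ℝ) x).indicator (fun _ => (1:ℝ)) y - ∫ s in y..(1:ℝ), μ₀ s) *
        Real.exp (-∫ v in (0:ℝ)..y, 2 * b v / sq v)

theorem hasDerivWithinAt_primitive_Icc {F : ℝ → ℝ} {a b x : ℝ}
    (hF : ContinuousOn F (Icc a b)) (hx : x ∈ Icc a b) :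
    HasDerivWithinAt (fun u => ∫ t in a..u, F t) (F x) (Icc a b) x := by
  have : Fact (x ∈ Icc a b) := ⟨hx⟩
  refine integral_hasDerivWithinAt_right ?_
    (hF.stronglyMeasurableAtFilter_nhdsWithin measurableSet_Icc x) (hF x hx)
  exact (hF.mono (Icc_subset_Icc_right hx.2)).intervalIntegrable_of_Icc hx.1

theorem continuousOn_primitive_Icc {F : ℝ → ℝ} {a b : ℝ} (hF : ContinuousOn F (Icc a b)) :
    ContinuousOn (fun u => ∫ t in a..u, F t) (Icc a b) :=
  fun _ hx => (hasDerivWithinAt_primitive_Icc hF hx).continuousWithinAt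

theorem integral_mul_indicator_Icc_sub {A E M : ℝ → ℝ} {a b x : ℝ}
    (hA : ContinuousOn A (Icc a b)) (hE : ContinuousOn E (Icc a b))
    (hM : ContinuousOn M (Icc a b)) (hx : x ∈ Icc a b) :
    (∫ y in a..b, A y * ((Icc a x).indicator (fun _ => (1:ℝ)) y - M y) * E y)
      = (∫ y in a..x, A y * E y) - ∫ y in a..b, A y * M y * E y := by
  have hab : a ≤ b := hx.1.trans hx.2
  have hAE : IntervalIntegrable (fun y => A y * E y) volume a b :=
    (hA.mul hE).intervalIntegrable_of_Icc hab
  have hAME : IntervalIntegrable (fun y => A y * M y * E y) volume a b :=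
    ((hA.mul hM).mul hE).intervalIntegrable_of_Icc hab
  have hind : IntervalIntegrable ({y | y ≤ x}.indicator fun y => A y * E y) volume a b := by
    rw [intervalIntegrable_iff] at hAE ⊢
    exact hAE.indicator measurableSet_Iic
  rw [← integral_indicator hx, ← integral_sub hind hAME]
  refine integral_congr fun y hy => ?_
  rw [uIcc_of_le hab] at hy
  by_cases hyx : y ≤ x
  · simp only [indicator, mem_Icc, mem_ofPred_eq, hy.1, hyx, and_self, if_true]
    ring
  · simp only [indicator, mem_Icc, mem_ofPred_eq, hyx, and_false, if_false]
    ring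

section InvariantDensity

variable {b sq : ℝ → ℝ}

theorem continuousOn_two_mul_div (hb : ContinuousOn b (Icc 0 1)) (hs : ContinuousOn sq (Icc 0 1))
    (hpos : ∀ x ∈ Icc (0:ℝ) 1, 0 < sq x) :
    ContinuousOn (fun y => 2 * b y / sq y) (Icc 0 1) :=
  (continuousOn_const.mul hb).div hs fun x hx => (hpos x hx).ne'

theorem normConst_pos (hb : ContinuousOn b (Icc 0 1)) (hs : ContinuousOn sq (Icc 0 1))
    (hpos : ∀ x ∈ Icc (0:ℝ) 1, 0 < sq x) : 0 < normConst b sq := by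
  have hB := continuousOn_primitive_Icc (continuousOn_two_mul_div hb hs hpos)
  have hc : ContinuousOn
      (fun y => (1 / sq y) * Real.exp (∫ z in (0:ℝ)..y, 2 * b z / sq z)) (Icc 0 1) :=
    (continuousOn_const.div hs fun x hx => (hpos x hx).ne').mul hB.rexp
  refine intervalIntegral_pos_of_pos_on (hc.intervalIntegrable_of_Icc zero_le_one)
    (fun x hx => ?_) one_pos
  have := hpos x (Ioo_subset_Icc_self hx)
  positivity

theorem continuousOn_invDens (hb : ContinuousOn b (Icc 0 1)) (hs : ContinuousOn sq (Icc 0 1))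
    (hpos : ∀ x ∈ Icc (0:ℝ) 1, 0 < sq x) : ContinuousOn (invDens b sq) (Icc 0 1) := by
  have hB := continuousOn_primitive_Icc (continuousOn_two_mul_div hb hs hpos)
  exact (continuousOn_const.div (continuousOn_const.mul hs) fun x hx =>
    mul_ne_zero (normConst_pos hb hs hpos).ne' (hpos x hx).ne').mul hB.rexp

theorem normConst_mul_invDens_mul_exp_neg (hG : normConst b sq ≠ 0) (x : ℝ) :
    normConst b sq * (invDens b sq x * Real.exp (-∫ v in (0:ℝ)..x, 2 * b v / sq v))
      = 1 / sq x := by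
  rw [invDens, mul_assoc, ← Real.exp_add, add_neg_cancel, Real.exp_zero, mul_one,
    one_div, mul_inv, mul_inv_cancel_left₀ hG, one_div]

end InvariantDensity

/-- `Jf` is twice differentiable on `[0,1]` and satisfies the generator identity
`½σ²(Jf)'' + b(Jf)' = f - ∫ f dμ`; consequently, if `∫ f μ₀ = 0`, then
`(L - μ₀(L)) Jf = f` on `[0,1]`. -/
theorem stmt2 (d : ℝ) (hd : 0 < d) (σ b μ₀ f : ℝ → ℝ)
    (hσ : ContinuousOn σ (Icc 0 1)) (hb : ContinuousOn b (Icc 0 1))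
    (hσd : ∀ x ∈ Icc (0:ℝ) 1, d ≤ σ x ^ 2)
    (hμ₀meas : Measurable μ₀) (hμ₀nonneg : ∀ x ∈ Icc (0:ℝ) 1, 0 ≤ μ₀ x)
    (hμ₀int : IntervalIntegrable μ₀ volume 0 1)
    (hμ₀one : (∫ x in (0:ℝ)..1, μ₀ x) = 1)
    (hf : ContinuousOn f (Icc 0 1)) :
    ∃ g₁ g₂ : ℝ → ℝ,
      (∀ x ∈ Icc (0:ℝ) 1,
        HasDerivWithinAt (Jop b (fun t => σ t ^ 2) μ₀ f) (g₁ x) (Icc 0 1) x) ∧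
      (∀ x ∈ Icc (0:ℝ) 1, HasDerivWithinAt g₁ (g₂ x) (Icc 0 1) x) ∧
      (∀ x ∈ Icc (0:ℝ) 1,
        (1 / 2) * σ x ^ 2 * g₂ x + b x * g₁ x
          = f x - ∫ w in (0:ℝ)..1, f w * invDens b (fun t => σ t ^ 2) w) ∧
      ((∫ x in (0:ℝ)..1, f x * μ₀ x) = 0 →
        ∀ x ∈ Icc (0:ℝ) 1,
          (1 / 2) * σ x ^ 2 * g₂ x + b x * g₁ x
            - (∫ w in (0:ℝ)..1,
                ((1 / 2) * σ w ^ 2 * g₂ w + b w * g₁ w) * μ₀ w) = f x) := by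
  have hs : ContinuousOn (fun t => σ t ^ 2) (Icc 0 1) := hσ.pow 2
  have hpos : ∀ x ∈ Icc (0:ℝ) 1, 0 < σ x ^ 2 := fun x hx => hd.trans_le (hσd x hx)
  have hG : normConst b (fun t => σ t ^ 2) ≠ 0 := (normConst_pos hb hs hpos).ne'
  have hq : ContinuousOn (fun y => 2 * b y / σ y ^ 2) (Icc 0 1) :=
    continuousOn_two_mul_div hb hs hpos
  set c := ∫ w in (0:ℝ)..1, f w * invDens b (fun t => σ t ^ 2) w
  have hh : ContinuousOn (fun z => (f z - c) * invDens b (fun t => σ t ^ 2) z) (Icc 0 1) :=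
    (hf.sub continuousOn_const).mul (continuousOn_invDens hb hs hpos)
  set A : ℝ → ℝ := fun y => ∫ z in (0:ℝ)..y, (f z - c) * invDens b (fun t => σ t ^ 2) z
  set E : ℝ → ℝ := fun y => Real.exp (-∫ v in (0:ℝ)..y, 2 * b v / σ v ^ 2)
  have hAc : ContinuousOn A (Icc 0 1) := continuousOn_primitive_Icc hh
  have hEc : ContinuousOn E (Icc 0 1) := (continuousOn_primitive_Icc hq).neg.rexp
  have hMc : ContinuousOn (fun y => ∫ s in y..(1:ℝ), μ₀ s) (Icc 0 1) := by
    have h := continuousOn_primitive_interval' hμ₀int.symm (left_mem_uIcc (a := (1:ℝ)) (b := 0))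
    rw [uIcc_of_ge zero_le_one] at h
    exact h.neg.congr fun y _ => integral_symm 1 y
  have hJ : ∀ x ∈ Icc (0:ℝ) 1, Jop b (fun t => σ t ^ 2) μ₀ f x
      = 2 * normConst b (fun t => σ t ^ 2) * ((∫ y in (0:ℝ)..x, A y * E y)
        - ∫ y in (0:ℝ)..1, A y * (∫ s in y..(1:ℝ), μ₀ s) * E y) := fun x hx => by
    rw [← integral_mul_indicator_Icc_sub hAc hEc hMc hx]
    rfl
  have hgen : ∀ x ∈ Icc (0:ℝ) 1,
      (1 / 2) * σ x ^ 2 * (2 * normConst b (fun t => σ t ^ 2) *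
        ((f x - c) * invDens b (fun t => σ t ^ 2) x * E x
          + A x * (E x * -(2 * b x / σ x ^ 2))))
        + b x * (2 * normConst b (fun t => σ t ^ 2) * (A x * E x)) = f x - c := fun x hx => by
    have hx0 : σ x ≠ 0 := fun h => by simpa [h] using hpos x hx
    have key : normConst b (fun t => σ t ^ 2) * (invDens b (fun t => σ t ^ 2) x * E x)
        = 1 / σ x ^ 2 := normConst_mul_invDens_mul_exp_neg hG x
    calc _ = σ x ^ 2 * (f x - c) *
          (normConst b (fun t => σ t ^ 2) * (invDens b (fun t => σ t ^ 2) x * E x)) := by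
          field_simp
          ring
      _ = f x - c := by
          rw [key]
          field_simp
  refine ⟨fun x => 2 * normConst b (fun t => σ t ^ 2) * (A x * E x), _, fun x hx => ?_,
    fun x hx => ?_, hgen, fun hf0 x hx => ?_⟩
  · exact (((hasDerivWithinAt_primitive_Icc (hAc.mul hEc) hx).sub_const _).const_mul _).congr
      hJ (hJ x hx)
  · exact ((hasDerivWithinAt_primitive_Icc hh hx).mul
      (hasDerivWithinAt_primitive_Icc hq hx).neg.exp).const_mul _
  · have hfμ : IntervalIntegrable (fun w => f w * μ₀ w) volume 0 1 :=
      hμ₀int.continuousOn_mul (by rwa [uIcc_of_le zero_le_one])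
    have hint : (∫ w in (0:ℝ)..1, (f w - c) * μ₀ w) = -c := by
      simp only [sub_mul]
      rw [integral_sub hfμ (hμ₀int.const_mul c), intervalIntegral.integral_const_mul, hf0, hμ₀one]
      ring
    rw [hgen x hx, integral_congr (g := fun w => (f w - c) * μ₀ w), hint]
    · ring
    · intro w hw
      rw [uIcc_of_le zero_le_one] at hw
      exact congrArg (· * μ₀ w) (hgen w hw)
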